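/- arXiv:1001.2371 — 6 statements merged into one kernel-verified Lean document; each statement's English description precedes it below -/
import Mathlib

section
/- Let S be a compact topological space and g ∈ C[x₁,…,xₙ](S) such that g_s is not the zero polynomial for any s ∈ S. Then FRad(⟨g⟩) = √⟨g⟩, where ⟨g⟩ is the principal ideal of C[x₁,…,xₙ](S) generated by g: a polynomial f satisfies f_s ∈ √(⟨g⟩|_s) for all s ∈ S if and only if some power of f lies in ⟨g⟩. -/
open MvPolynomial

noncomputable section

/-- Evaluation of continuous functions at a point, as a ring homomorphism. -/
def evalAt {S : Type} [TopologicalSpace S] (s : S) : C(S, ℂ) →+* ℂ where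
  toFun f := f s
  map_one' := rfl
  map_mul' _ _ := rfl
  map_zero' := rfl
  map_add' _ _ := rfl

/-- Coefficientwise evaluation at `s`, sending `f ∈ C[x₁,…,xₙ](S)` to the fibre
polynomial `f_s ∈ ℂ[x₁,…,xₙ]`. -/
def fiberMap {S : Type} [TopologicalSpace S] (n : ℕ) (s : S) :
    MvPolynomial (Fin n) C(S, ℂ) →+* MvPolynomial (Fin n) ℂ :=
  MvPolynomial.map (evalAt s)

/-- The power of `f` needed to be divisible by `g` is bounded by the total degree of `g`. -/
theorem dvd_pow_totalDegree_of_dvd_pow {σ K : Type*} [Field K] {f g : MvPolynomial σ K} {k : ℕ}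
    (hg : g ≠ 0) (h : g ∣ f ^ k) : g ∣ f ^ g.totalDegree := by
  induction g using UniqueFactorizationMonoid.induction_on_prime with
  | h₁ => exact absurd rfl hg
  | h₂ x hx => exact hx.dvd
  | h₃ a p ha hp ih =>
    have hpf : p ∣ f := hp.dvd_of_dvd_pow ((dvd_mul_right p a).trans h)
    have haf := ih ha ((dvd_mul_left a p).trans h)
    have hdeg : 1 ≤ p.totalDegree := by
      by_contra! hlt
      have hC := totalDegree_eq_zero_iff_eq_C.mp (Nat.lt_one_iff.mp hlt)
      have h0 : p.coeff 0 ≠ 0 := fun h0 => hp.ne_zero (by rw [hC, h0, C_0])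
      exact hp.not_isUnit (hC ▸ (isUnit_iff_ne_zero.mpr h0).map C)
    rw [totalDegree_mul_of_isDomain hp.ne_zero ha]
    calc p * a ∣ f ^ 1 * f ^ a.totalDegree := mul_dvd_mul (by simpa using hpf) haf
      _ = f ^ (1 + a.totalDegree) := (pow_add _ _ _).symm
      _ ∣ _ := pow_dvd_pow _ (by omega)

@[simp]
theorem coeff_fiberMap {S : Type} [TopologicalSpace S] {n : ℕ} (s : S)
    (p : MvPolynomial (Fin n) C(S, ℂ)) (m : Fin n →₀ ℕ) :
    (fiberMap n s p).coeff m = p.coeff m s :=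
  coeff_map _ _ _

theorem totalDegree_fiberMap_le {S : Type} [TopologicalSpace S] {n : ℕ} (s : S)
    (p : MvPolynomial (Fin n) C(S, ℂ)) : (fiberMap n s p).totalDegree ≤ p.totalDegree :=
  Finset.sup_mono (support_map_subset _ _)

open scoped ComplexOrder in
/-- The solution of a continuous family of injective linear systems is continuous. -/
theorem continuous_of_mulVec_eq {S : Type*} [TopologicalSpace S] {ι κ : Type*} [Fintype ι]
    [Fintype κ] {M : S → Matrix ι κ ℂ} {v : S → κ → ℂ} {w : S → ι → ℂ}
    (hM : Continuous M) (hw : Continuous w) (hinj : ∀ s, Function.Injective (M s).mulVec)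
    (h : ∀ s, (M s).mulVec (v s) = w s) : Continuous v := by
  classical
  let G : S → Matrix κ κ ℂ := fun s => (M s).conjTranspose * M s
  have hG : Continuous G := hM.matrix_conjTranspose.matrix_mul hM
  have hdet : ∀ s, (G s).det ≠ 0 := fun s =>
    (Matrix.PosDef.conjTranspose_mul_self (M s) (hinj s)).det_pos.ne'
  have hv : v = fun s => (G s).det⁻¹ •
      (G s).adjugate.mulVec ((M s).conjTranspose.mulVec (w s)) := by
    funext s
    rw [← h s, Matrix.mulVec_mulVec (v s), Matrix.mulVec_mulVec, Matrix.adjugate_mul,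
      Matrix.smul_mulVec, Matrix.one_mulVec, smul_smul, inv_mul_cancel₀ (hdet s), one_smul]
  rw [hv]
  exact (hG.matrix_det.inv₀ hdet).smul
    (hG.matrix_adjugate.matrix_mulVec (hM.matrix_conjTranspose.matrix_mulVec hw))

/-- A fibrewise multiple of a fibrewise nonzero polynomial is a multiple. -/
theorem dvd_of_fiberMap_dvd {S : Type} [TopologicalSpace S] {n : ℕ}
    {g F : MvPolynomial (Fin n) C(S, ℂ)} (hg : ∀ s : S, fiberMap n s g ≠ 0)
    (h : ∀ s : S, fiberMap n s g ∣ fiberMap n s F) : g ∣ F := by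
  classical
  choose q hq using h
  let A : Finset (Fin n →₀ ℕ) :=
    Finset.Iic (Finsupp.equivFunOnFinite.symm fun _ => F.totalDegree)
  have hqA : ∀ s, (q s).support ⊆ A := by
    intro s m hm
    have hq0 : q s ≠ 0 := by
      rintro h0
      simp [h0] at hm
    have hdeg : (q s).totalDegree ≤ F.totalDegree := by
      have h1 := totalDegree_fiberMap_le s F
      rw [hq s, totalDegree_mul_of_isDomain (hg s) hq0] at h1
      omega
    rw [Finset.mem_Iic, Finsupp.le_def]
    intro i
    exact (Finsupp.le_degree i m).trans ((le_totalDegree hm).trans hdeg)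
  let B : Finset (Fin n →₀ ℕ) := A.biUnion fun a => (g * monomial a 1).support
  let M : S → Matrix B A ℂ := fun s b a => (g * monomial a.1 1).coeff b.1 s
  have hmul : ∀ s a b (c : ℂ), (fiberMap n s g * monomial a c).coeff b =
      (g * monomial a 1).coeff b s * c := by
    intro s a b c
    have hmon : monomial a c = C c * fiberMap n s (monomial a 1) := by
      rw [fiberMap, map_monomial, map_one, C_mul_monomial, mul_one]
    rw [hmon, mul_left_comm, ← map_mul, coeff_C_mul, coeff_fiberMap, mul_comm]
  have hMv : ∀ s (v : A → ℂ) (b : B), (M s).mulVec v b =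
      (fiberMap n s g * ∑ a : A, monomial a.1 (v a)).coeff b.1 := by
    intro s v b
    rw [Finset.mul_sum, coeff_sum]
    exact Finset.sum_congr rfl fun a _ => (hmul s a b (v a)).symm
  have hinj : ∀ s, Function.Injective (M s).mulVec := by
    intro s
    rw [← Matrix.coe_mulVecLin, injective_iff_map_eq_zero]
    intro v hv
    have hprod : fiberMap n s g * ∑ a : A, monomial a.1 (v a) = 0 := by
      ext b
      rw [coeff_zero]
      by_cases hb : b ∈ B
      · rw [← hMv s v ⟨b, hb⟩]
        exact congrFun hv _
      · rw [Finset.mul_sum, coeff_sum]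
        refine Finset.sum_eq_zero fun a _ => ?_
        have hb' : (g * monomial a.1 1).coeff b = 0 :=
          notMem_support_iff.mp fun hmem => hb (Finset.mem_biUnion.mpr ⟨a, a.2, hmem⟩)
        rw [hmul, hb', ContinuousMap.zero_apply, zero_mul]
    have hsum := (mul_eq_zero.mp hprod).resolve_left (hg s)
    funext a
    have := congrArg (coeff a.1) hsum
    simpa [coeff_sum, coeff_monomial, Subtype.val_inj] using this
  have hqsum : ∀ s, ∑ a : A, monomial a.1 ((q s).coeff a.1) = q s := by
    intro s
    rw [Finset.sum_coe_sort A fun a => monomial a ((q s).coeff a)]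
    conv_rhs => rw [(q s).as_sum]
    refine (Finset.sum_subset (hqA s) fun a _ ha => ?_).symm
    rw [notMem_support_iff.mp ha, monomial_zero]
  have hcont : Continuous fun s (a : A) => (q s).coeff a.1 := by
    refine continuous_of_mulVec_eq (M := M) (w := fun s b => F.coeff b.1 s) ?_ ?_ hinj ?_
    · exact continuous_matrix fun b a => ContinuousMap.continuous _
    · exact continuous_pi fun b => ContinuousMap.continuous _
    · intro s
      funext b
      rw [hMv, hqsum, ← hq, coeff_fiberMap]
  let Q : MvPolynomial (Fin n) C(S, ℂ) :=
    ∑ a : A, monomial a.1 ⟨fun s => (q s).coeff a.1, (continuous_pi_iff.mp hcont) a⟩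
  have hQ : ∀ s, fiberMap n s Q = q s := by
    intro s
    rw [← hqsum s, map_sum]
    exact Finset.sum_congr rfl fun a _ => map_monomial _ _ _
  refine ⟨Q, ?_⟩
  ext m s
  rw [← coeff_fiberMap, ← coeff_fiberMap, map_mul, hQ, hq]

/-- if `S` is compact and `g_s` is never the zero polynomial, then
`FRad(⟨g⟩) = √⟨g⟩`. -/
theorem stmt2 (S : Type) [TopologicalSpace S] [CompactSpace S] (n : ℕ)
    (g : MvPolynomial (Fin n) C(S, ℂ)) (hg : ∀ s : S, fiberMap n s g ≠ 0)
    (f : MvPolynomial (Fin n) C(S, ℂ)) :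
    (∀ s : S, fiberMap n s f ∈ ((Ideal.span {g}).map (fiberMap n s)).radical)
      ↔ ∃ m : ℕ, f ^ m ∈ Ideal.span {g} := by
  simp only [Ideal.map_span, Set.image_singleton, Ideal.mem_span_singleton, Ideal.mem_radical_iff]
  constructor
  · intro h
    refine ⟨g.totalDegree, dvd_of_fiberMap_dvd hg fun s => ?_⟩
    obtain ⟨k, hk⟩ := h s
    rw [map_pow]
    exact (dvd_pow_totalDegree_of_dvd_pow (hg s) hk).trans
      (pow_dvd_pow _ (totalDegree_fiberMap_le s g))
  · rintro ⟨m, hm⟩ s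
    exact ⟨m, by simpa using map_dvd (fiberMap n s) hm⟩
end
end

section
/- Let S be a topological space and let {g₁,…,g_k} be a Groebner basis of an ideal I ⊆ C[x₁,…,xₙ](S) with respect to a fixed monomial ordering. Then for every s ∈ S, {g₁,ₛ,…,g_k,ₛ} is a Groebner basis of the ideal I|_s ⊆ ℂ[x₁,…,xₙ], i.e. ⟨LT(g₁,ₛ),…,LT(g_k,ₛ)⟩ = ⟨LT(h) : h ∈ I|_s, h ≠ 0⟩ in ℂ[x₁,…,xₙ]. -/
open MvPolynomial

noncomputable section

/-- The multidegree (largest exponent of a monomial with nonzero coefficient) of a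
polynomial with respect to a monomial order. -/
def mDegree {σ R : Type*} [CommSemiring R] (mo : MonomialOrder σ)
    (f : MvPolynomial σ R) : σ →₀ ℕ :=
  mo.toSyn.symm (f.support.sup fun α => mo.toSyn α)

/-- The leading coefficient of `f` with respect to a monomial order. -/
def mLC {σ R : Type*} [CommSemiring R] (mo : MonomialOrder σ) (f : MvPolynomial σ R) : R :=
  f.coeff (mDegree mo f)

/-- The leading term `LT(f) = LC(f)·LM(f)` of `f` with respect to a monomial order. -/
def mLT {σ R : Type*} [CommSemiring R] (mo : MonomialOrder σ) (f : MvPolynomial σ R) :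
    MvPolynomial σ R :=
  MvPolynomial.monomial (mDegree mo f) (mLC mo f)

/-- The ideal of leading terms `⟨LT(f) : f ∈ I, f ≠ 0⟩`. -/
def ltIdeal {σ R : Type*} [CommRing R] (mo : MonomialOrder σ)
    (I : Ideal (MvPolynomial σ R)) : Ideal (MvPolynomial σ R) :=
  Ideal.span {p | ∃ f ∈ I, f ≠ 0 ∧ p = mLT mo f}

/-- `G` is a Groebner basis of the ideal `I ⊆ C[x_σ](T)`: it generates `I`, each leading
term is nonvanishing on `T`, and its leading terms generate the ideal of leading terms. -/
def IsGroebnerBasis {σ : Type*} (T : Type) [TopologicalSpace T] (mo : MonomialOrder σ)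
    (I : Ideal (MvPolynomial σ C(T, ℂ))) (G : Finset (MvPolynomial σ C(T, ℂ))) : Prop :=
  Ideal.span (G : Set (MvPolynomial σ C(T, ℂ))) = I ∧
  (∀ g ∈ G, ∀ t : T, mLC mo g t ≠ 0) ∧
  Ideal.span (mLT mo '' (G : Set (MvPolynomial σ C(T, ℂ)))) = ltIdeal mo I

/-- An ideal admitting a Groebner basis. -/
def IsGroebnerIdeal {σ : Type*} (T : Type) [TopologicalSpace T] (mo : MonomialOrder σ)
    (I : Ideal (MvPolynomial σ C(T, ℂ))) : Prop :=
  ∃ G : Finset (MvPolynomial σ C(T, ℂ)), IsGroebnerBasis T mo I G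

/-- A ring homomorphism which does not kill the leading coefficient preserves the degree. -/
theorem MonomialOrder.degree_map_of_leadingCoeff_ne_zero {σ R K : Type*} [CommSemiring R]
    [CommSemiring K] (mo : MonomialOrder σ) (φ : R →+* K) {f : MvPolynomial σ R}
    (h : φ (mo.leadingCoeff f) ≠ 0) : mo.degree (MvPolynomial.map φ f) = mo.degree f := by
  apply mo.toSyn.injective
  apply le_antisymm
  · exact mo.degree_le_iff.mpr fun d hd => mo.le_degree (MvPolynomial.support_map_subset φ f hd)
  · apply mo.le_degree
    rw [MvPolynomial.mem_support_iff, MvPolynomial.coeff_map]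
    exact h

/-- A ring homomorphism which does not kill the leading coefficient commutes with taking
leading terms. -/
theorem MonomialOrder.leadingTerm_map_of_leadingCoeff_ne_zero {σ R K : Type*} [CommSemiring R]
    [CommSemiring K] (mo : MonomialOrder σ) (φ : R →+* K) {f : MvPolynomial σ R}
    (h : φ (mo.leadingCoeff f) ≠ 0) :
    mo.leadingTerm (MvPolynomial.map φ f) = MvPolynomial.map φ (mo.leadingTerm f) := by
  rw [leadingTerm, leadingTerm, MvPolynomial.map_monomial, leadingCoeff,
    mo.degree_map_of_leadingCoeff_ne_zero φ h, MvPolynomial.coeff_map]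
  rfl

/-- If the leading term of `f ≠ 0` lies in the ideal generated by the leading terms of `G`,
then the degree of `f` is divisible by the degree of some element of `G`. -/
theorem MonomialOrder.exists_degree_le_of_leadingTerm_mem_span {σ R : Type*} [CommSemiring R]
    (mo : MonomialOrder σ) {G : Set (MvPolynomial σ R)} {f : MvPolynomial σ R} (hf : f ≠ 0)
    (h : mo.leadingTerm f ∈ Ideal.span (mo.leadingTerm '' G)) :
    ∃ g ∈ G, mo.degree g ≤ mo.degree f := by
  have hle : Ideal.span (mo.leadingTerm '' G) ≤
      Ideal.span ((fun d => monomial d (1 : R)) '' (mo.degree '' G)) := by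
    rw [Ideal.span_le]
    rintro _ ⟨g, hg, rfl⟩
    rw [leadingTerm, ← mul_one (mo.leadingCoeff g), ← C_mul_monomial]
    exact Ideal.mul_mem_left _ _ (Ideal.subset_span ⟨_, ⟨g, hg, rfl⟩, rfl⟩)
  obtain ⟨_, ⟨g, hg, rfl⟩, hgf⟩ := mem_ideal_span_monomial_image.mp (hle h) (mo.degree f) (by
    classical
    rw [mem_support_iff, leadingTerm, coeff_monomial, if_pos rfl]
    exact mo.leadingCoeff_ne_zero_iff.mpr hf)
  exact ⟨g, hg, hgf⟩

/-- If every nonzero element of `I` has degree divisible by that of an element of `I` with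
invertible leading coefficient, then every element of the image of `I` with nonzero image under
a coefficient map `φ` can be lifted to `I` without `φ` killing the leading coefficient. -/
theorem MonomialOrder.exists_mem_map_eq_leadingCoeff_ne_zero {σ R K : Type*} [CommRing R]
    [CommRing K] (mo : MonomialOrder σ) (φ : R →+* K) {I : Ideal (MvPolynomial σ R)}
    (hI : ∀ f ∈ I, f ≠ 0 → ∃ g ∈ I, IsUnit (mo.leadingCoeff g) ∧ mo.degree g ≤ mo.degree f)
    {f : MvPolynomial σ R} (hf : f ∈ I) (hne : MvPolynomial.map φ f ≠ 0) :
    ∃ f' ∈ I, MvPolynomial.map φ f' = MvPolynomial.map φ f ∧ φ (mo.leadingCoeff f') ≠ 0 := by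
  induction hd : mo.toSyn (mo.degree f) using WellFoundedLT.induction generalizing f with
  | ind d ih =>
    by_cases hc : φ (mo.leadingCoeff f) = 0
    · have hf0 : f ≠ 0 := by
        rintro rfl
        exact hne (map_zero _)
      obtain ⟨g, hg, hu, hle⟩ := hI f hf hf0
      obtain ⟨u, hu⟩ := hu
      set q : MvPolynomial σ R :=
        monomial (mo.degree f - mo.degree g) (mo.leadingCoeff f * ↑u⁻¹) with hq
      have hmap : MvPolynomial.map φ (f - q * g) = MvPolynomial.map φ f := by
        simp [hq, map_monomial, hc]
      have hne' : f - q * g ≠ 0 := by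
        intro h
        rw [h, map_zero] at hmap
        exact hne hmap.symm
      have hdq : mo.toSyn (mo.degree (q * g)) ≤ mo.toSyn (mo.degree f) := by
        refine mo.degree_mul_le.trans ?_
        have := mo.degree_monomial_le (d := mo.degree f - mo.degree g)
          (mo.leadingCoeff f * ↑u⁻¹)
        calc _ ≤ mo.toSyn (mo.degree f - mo.degree g + mo.degree g) := by
              rw [map_add, map_add]
              gcongr
          _ = _ := by rw [tsub_add_cancel_of_le hle]
      have hcoeff : (f - q * g).coeff (mo.degree f) = 0 := by
        have hqg : (q * g).coeff (mo.degree f) = mo.leadingCoeff f := by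
          conv_lhs => rw [← tsub_add_cancel_of_le hle]
          rw [hq, coeff_monomial_mul]
          change _ * mo.leadingCoeff g = _
          rw [← hu, mul_assoc, Units.inv_mul, mul_one]
        rw [coeff_sub, hqg]
        exact sub_self _
      have hlt : mo.toSyn (mo.degree (f - q * g)) < d := by
        rw [← hd]
        refine lt_of_le_of_ne (mo.degree_sub_le.trans (max_le le_rfl hdq)) fun h => ?_
        apply mo.leadingCoeff_ne_zero_iff.mpr hne'
        rw [leadingCoeff, mo.toSyn.injective h, hcoeff]
      obtain ⟨f', hf', hf'm, hf'c⟩ :=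
        ih _ hlt (sub_mem hf (I.mul_mem_left q hg)) (hmap ▸ hne) rfl
      exact ⟨f', hf', hf'm.trans hmap, hf'c⟩
    · exact ⟨f, hf, rfl, hc⟩

theorem evalAt_surjective {S : Type} [TopologicalSpace S] (s : S) :
    Function.Surjective (evalAt s) :=
  fun c => ⟨ContinuousMap.const S c, rfl⟩

/-- if `{g₁,…,g_k}` is a Groebner basis of `I ⊆ C[x₁,…,xₙ](S)`, then for every
`s ∈ S` the fibres `{g₁,ₛ,…,g_k,ₛ}` form a Groebner basis of `I|_s ⊆ ℂ[x₁,…,xₙ]`, i.e.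
`⟨LT(g₁,ₛ),…,LT(g_k,ₛ)⟩ = ⟨LT(h) : h ∈ I|_s, h ≠ 0⟩`. -/
theorem stmt3 (S : Type) [TopologicalSpace S] (n : ℕ) (mo : MonomialOrder (Fin n))
    (I : Ideal (MvPolynomial (Fin n) C(S, ℂ))) (G : Finset (MvPolynomial (Fin n) C(S, ℂ)))
    (hG : IsGroebnerBasis S mo I G) (s : S) :
    Ideal.span ((fun g => mLT mo (fiberMap n s g)) '' (G : Set (MvPolynomial (Fin n) C(S, ℂ))))
      = ltIdeal mo (I.map (fiberMap n s)) := by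
  obtain ⟨hspan, hunit, hlt⟩ := hG
  have hGI : ∀ g ∈ G, g ∈ I := fun g hg => hspan ▸ Ideal.subset_span hg
  have hfib : ∀ f : MvPolynomial (Fin n) C(S, ℂ), evalAt s (mo.leadingCoeff f) ≠ 0 →
      mLT mo (fiberMap n s f) = fiberMap n s (mLT mo f) := fun f hf =>
    mo.leadingTerm_map_of_leadingCoeff_ne_zero (evalAt s) hf
  have hI : ∀ f ∈ I, f ≠ 0 →
      ∃ g ∈ I, IsUnit (mo.leadingCoeff g) ∧ mo.degree g ≤ mo.degree f := by
    intro f hf hf0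
    have hmem : mLT mo f ∈ Ideal.span (mLT mo '' (G : Set (MvPolynomial (Fin n) C(S, ℂ)))) :=
      hlt ▸ Ideal.subset_span ⟨f, hf, hf0, rfl⟩
    obtain ⟨g, hg, hle⟩ := mo.exists_degree_le_of_leadingTerm_mem_span hf0 hmem
    exact ⟨g, hGI g hg, (ContinuousMap.isUnit_iff_forall_ne_zero _).mpr (hunit g hg), hle⟩
  apply le_antisymm
  · rw [Ideal.span_le]
    rintro _ ⟨g, hg, rfl⟩
    refine Ideal.subset_span ⟨_, Ideal.mem_map_of_mem _ (hGI g hg), fun h => ?_, rfl⟩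
    apply hunit g hg s
    have := congrArg (coeff (mDegree mo g)) h
    rwa [fiberMap, coeff_map, coeff_zero] at this
  · rw [ltIdeal, Ideal.span_le]
    rintro _ ⟨h, hh, h0, rfl⟩
    obtain ⟨f, hf, rfl⟩ := (Ideal.mem_map_iff_of_surjective (fiberMap n s)
      (MvPolynomial.map_surjective _ (evalAt_surjective s))).mp hh
    obtain ⟨f', hf', hmap, hc⟩ := mo.exists_mem_map_eq_leadingCoeff_ne_zero (evalAt s) hI hf h0
    have hf'0 : f' ≠ 0 := by
      rintro rfl
      exact h0 (hmap.symm.trans (map_zero _))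
    have hmem : mLT mo f' ∈ Ideal.span (mLT mo '' (G : Set (MvPolynomial (Fin n) C(S, ℂ)))) :=
      hlt ▸ Ideal.subset_span ⟨f', hf', hf'0, rfl⟩
    have himage : (fun g => mLT mo (fiberMap n s g)) '' (G : Set (MvPolynomial (Fin n) C(S, ℂ)))
        = fiberMap n s '' (mLT mo '' (G : Set (MvPolynomial (Fin n) C(S, ℂ)))) := by
      rw [Set.image_image]
      exact Set.image_congr fun g hg => hfib g (hunit g hg s)
    rw [himage, ← Ideal.map_span, ← show fiberMap n s f' = fiberMap n s f from hmap, hfib f' hc]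
    exact Ideal.mem_map_of_mem _ hmem
end
end

section
/- Let S ⊆ ℝ^m be a condensed space. Every condensed ideal I ⊆ C[x₁,…,xₙ](S) is finitely generated as an ideal. -/
open MvPolynomial

noncomputable section

/-- Evaluation of a complex-coefficient polynomial in `d` variables at a real point. -/
def polyEval (d : ℕ) (p : MvPolynomial (Fin d) ℂ) (x : Fin d → ℝ) : ℂ :=
  MvPolynomial.eval (fun i => (x i : ℂ)) p

/-- `V` is a real algebraic subset of `S ⊆ ℝᵈ`: the common zero set in `S` of finitely
many polynomial functions on `S`. -/
def IsRealAlgebraic {d : ℕ} (S V : Set (Fin d → ℝ)) : Prop :=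
  ∃ fs : Finset (MvPolynomial (Fin d) ℂ),
    V = {x | x ∈ S ∧ ∀ p ∈ fs, polyEval d p x = 0}

/-- `S ⊆ ℝᵈ` is condensed: every proper real algebraic subset of `S` is nowhere dense in
`S` (with its Euclidean subspace topology). -/
def IsCondensed {d : ℕ} (S : Set (Fin d → ℝ)) : Prop :=
  ∀ V : Set (Fin d → ℝ), IsRealAlgebraic S V → V ≠ S →
    IsNowhereDense ((Subtype.val ⁻¹' V : Set S))

/-- `f : S → ℂ` is a polynomial function on `S`. -/
def IsPolyFun {d : ℕ} (S : Set (Fin d → ℝ)) (f : C(S, ℂ)) : Prop :=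
  ∃ p : MvPolynomial (Fin d) ℂ, ∀ x : S, f x = polyEval d p x

/-- `f : S → ℂ` is a rational function on `S`: a quotient of polynomial functions whose
denominator never vanishes on `S`. -/
def IsRatFun {d : ℕ} (S : Set (Fin d → ℝ)) (f : C(S, ℂ)) : Prop :=
  ∃ p q : MvPolynomial (Fin d) ℂ, (∀ x : S, polyEval d q x ≠ 0) ∧
    ∀ x : S, f x = polyEval d p x / polyEval d q x

/-- A condensed element of `C[x₁,…,xₙ](S)`: all coefficients are rational functions. -/
def IsCondensedElem {d n : ℕ} (S : Set (Fin d → ℝ))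
    (F : MvPolynomial (Fin n) C(S, ℂ)) : Prop :=
  ∀ α : Fin n →₀ ℕ, IsRatFun S (MvPolynomial.coeff α F)

/-- A condensed ideal of `C[x₁,…,xₙ](S)`: an ideal generated by condensed elements. -/
def IsCondensedIdeal {d n : ℕ} (S : Set (Fin d → ℝ))
    (I : Ideal (MvPolynomial (Fin n) C(S, ℂ))) : Prop :=
  ∃ T : Set (MvPolynomial (Fin n) C(S, ℂ)),
    (∀ F ∈ T, IsCondensedElem S F) ∧ I = Ideal.span T

/-- `A` is a set of measure zero in `S`: `A ≠ S` and `A` is a countable intersection of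
countable unions of real algebraic subsets of `S`. -/
def MeasureZero {d : ℕ} (S A : Set (Fin d → ℝ)) : Prop :=
  A ≠ S ∧ ∃ V : ℕ → ℕ → Set (Fin d → ℝ),
    (∀ i j, IsRealAlgebraic S (V i j)) ∧ A = ⋂ i, ⋃ j, V i j

/-- Restriction of continuous functions on `S` to a subset `U ⊆ S`, as a ring hom. -/
def restrictHom {d : ℕ} {S U : Set (Fin d → ℝ)} (h : U ⊆ S) : C(S, ℂ) →+* C(U, ℂ) where
  toFun f := f.comp ⟨fun x => ⟨x.1, h x.2⟩, Continuous.subtype_mk continuous_subtype_val _⟩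
  map_one' := rfl
  map_mul' _ _ := rfl
  map_zero' := rfl
  map_add' _ _ := rfl

/-- Coefficientwise restriction `C[x₁,…,xₙ](S) → C[x₁,…,xₙ](U)` for `U ⊆ S`. -/
def polyRestrict {d : ℕ} (n : ℕ) {S U : Set (Fin d → ℝ)} (h : U ⊆ S) :
    MvPolynomial (Fin n) C(S, ℂ) →+* MvPolynomial (Fin n) C(U, ℂ) :=
  MvPolynomial.map (restrictHom h)

/-- `I(U)`: the ideal of `C[x₁,…,xₙ](U)` generated by the restrictions to `U ⊆ S` of the
elements of `I`. -/
def idealRes {d n : ℕ} {S : Set (Fin d → ℝ)} (I : Ideal (MvPolynomial (Fin n) C(S, ℂ)))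
    {U : Set (Fin d → ℝ)} (h : U ⊆ S) : Ideal (MvPolynomial (Fin n) C(U, ℂ)) :=
  I.map (polyRestrict n h)
/-- `I` is almost Groebner: there is a measure zero set `A ⊆ S` such that `I(S−A)` is a
Groebner ideal of `C[x₁,…,xₙ](S−A)`. -/
def IsAlmostGroebner {d n : ℕ} {S : Set (Fin d → ℝ)} (mo : MonomialOrder (Fin n))
    (I : Ideal (MvPolynomial (Fin n) C(S, ℂ))) : Prop :=
  ∃ A : Set (Fin d → ℝ), MeasureZero S A ∧
    IsGroebnerIdeal (↥(S \ A)) mo (idealRes I (Set.diff_subset : S \ A ⊆ S))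

/-- `I ⊆_a J`: there is a measure zero set `A` with `I(S−A) ⊆ J(S−A)`. -/
def AlmSubset {d n : ℕ} {S : Set (Fin d → ℝ)}
    (I J : Ideal (MvPolynomial (Fin n) C(S, ℂ))) : Prop :=
  ∃ A : Set (Fin d → ℝ), MeasureZero S A ∧
    idealRes I (Set.diff_subset : S \ A ⊆ S) ≤ idealRes J (Set.diff_subset : S \ A ⊆ S)

/-- `I =_a J` (via a single measure zero set): `I(S−A) = J(S−A)` for some measure zero `A`. -/
def AlmEqIdeal {d n : ℕ} {S : Set (Fin d → ℝ)}
    (I J : Ideal (MvPolynomial (Fin n) C(S, ℂ))) : Prop :=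
  ∃ A : Set (Fin d → ℝ), MeasureZero S A ∧
    idealRes I (Set.diff_subset : S \ A ⊆ S) = idealRes J (Set.diff_subset : S \ A ⊆ S)

/-- `f ∈_a I`: the restriction of `f` to `S−A` lies in `I(S−A)` for some measure zero `A`. -/
def AlmMem {d n : ℕ} {S : Set (Fin d → ℝ)} (f : MvPolynomial (Fin n) C(S, ℂ))
    (I : Ideal (MvPolynomial (Fin n) C(S, ℂ))) : Prop :=
  ∃ A : Set (Fin d → ℝ), MeasureZero S A ∧
    polyRestrict n (Set.diff_subset : S \ A ⊆ S) f ∈ idealRes I (Set.diff_subset : S \ A ⊆ S)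

/-- `V(K) ⊆ S × ℂⁿ`: the common zero set of the fibre polynomials of the elements of `K`. -/
def varV {d n : ℕ} {S : Set (Fin d → ℝ)} (K : Ideal (MvPolynomial (Fin n) C(S, ℂ))) :
    Set (↥S × (Fin n → ℂ)) :=
  {p | ∀ g ∈ K, MvPolynomial.eval p.2 (fiberMap n p.1 g) = 0}

/-- `X =_a Y` for subsets of `S × ℂⁿ`: they agree off `A × ℂⁿ` for some measure zero `A`. -/
def AlmEqSet {d n : ℕ} (S : Set (Fin d → ℝ)) (X Y : Set (↥S × (Fin n → ℂ))) : Prop :=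
  ∃ A : Set (Fin d → ℝ), MeasureZero S A ∧
    {p ∈ X | (p.1 : Fin d → ℝ) ∉ A} = {p ∈ Y | (p.1 : Fin d → ℝ) ∉ A}

/-- `X` is almost irreducible: it is not almost equal to a union `V(J₁) ∪ V(J₂)` for
condensed ideals `J₁, J₂` with `V(J₁) ≠_a X` and `V(J₂) ≠_a X`. -/
def AlmostIrreducible {d n : ℕ} {S : Set (Fin d → ℝ)} (X : Set (↥S × (Fin n → ℂ))) : Prop :=
  ¬ ∃ J₁ J₂ : Ideal (MvPolynomial (Fin n) C(S, ℂ)),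
      IsCondensedIdeal S J₁ ∧ IsCondensedIdeal S J₂ ∧
      AlmEqSet S X (varV J₁ ∪ varV J₂) ∧
      ¬ AlmEqSet S (varV J₁) X ∧ ¬ AlmEqSet S (varV J₂) X

/-- `J` is almost prime: for condensed `f, g`, `fg ∈_a J` implies `f ∈_a J` or `g ∈_a J`. -/
def AlmostPrime {d n : ℕ} {S : Set (Fin d → ℝ)}
    (J : Ideal (MvPolynomial (Fin n) C(S, ℂ))) : Prop :=
  ∀ f g : MvPolynomial (Fin n) C(S, ℂ), IsCondensedElem S f → IsCondensedElem S g →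
    AlmMem (f * g) J → AlmMem f J ∨ AlmMem g J

/-- `Q` is almost primary: for condensed `f, g`, `fg ∈_a Q` implies `f ∈_a Q` or
`g^k ∈_a Q` for some `k`. -/
def AlmostPrimary {d n : ℕ} {S : Set (Fin d → ℝ)}
    (Q : Ideal (MvPolynomial (Fin n) C(S, ℂ))) : Prop :=
  ∀ f g : MvPolynomial (Fin n) C(S, ℂ), IsCondensedElem S f → IsCondensedElem S g →
    AlmMem (f * g) Q → AlmMem f Q ∨ ∃ k : ℕ, AlmMem (g ^ k) Q

/-- The ring homomorphism sending a polynomial to its restriction to `S`, as a continuous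
function. -/
def polyFunHom {d : ℕ} (S : Set (Fin d → ℝ)) : MvPolynomial (Fin d) ℂ →+* C(S, ℂ) :=
  MvPolynomial.eval₂Hom (algebraMap ℂ C(S, ℂ))
    fun i => ⟨fun x => ((x : Fin d → ℝ) i : ℂ),
      Complex.continuous_ofReal.comp ((continuous_apply i).comp continuous_subtype_val)⟩

lemma polyFunHom_apply {d : ℕ} (S : Set (Fin d → ℝ)) (p : MvPolynomial (Fin d) ℂ) (x : S) :
    polyFunHom S p x = polyEval d p x := by
  have h : (evalAt x).comp (polyFunHom S) =
      MvPolynomial.eval fun i => ((x : Fin d → ℝ) i : ℂ) := by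
    apply MvPolynomial.ringHom_ext
    · intro c
      simp only [polyFunHom, RingHom.comp_apply, coe_eval₂Hom, eval₂_C, eval_C]
      rfl
    · intro i
      simp only [polyFunHom, RingHom.comp_apply, coe_eval₂Hom, eval₂_X, eval_X]
      rfl
  exact RingHom.congr_fun h p

/-- A rational function times a unit polynomial function is a polynomial function. -/
lemma IsRatFun.exists_isUnit_mul_eq {d : ℕ} {S : Set (Fin d → ℝ)} {f : C(S, ℂ)}
    (hf : IsRatFun S f) : ∃ p q : MvPolynomial (Fin d) ℂ,
      IsUnit (polyFunHom S q) ∧ polyFunHom S q * f = polyFunHom S p := by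
  obtain ⟨p, q, hq, hpq⟩ := hf
  refine ⟨p, q, ?_, ?_⟩
  · rw [ContinuousMap.isUnit_iff_forall_ne_zero]
    intro x
    rw [polyFunHom_apply]
    exact hq x
  · ext x
    rw [ContinuousMap.mul_apply, polyFunHom_apply, polyFunHom_apply, hpq x,
      mul_div_cancel₀ _ (hq x)]

/-- Denominators of a condensed element can be cleared by a unit. -/
lemma IsCondensedElem.exists_isUnit_mul_eq {d n : ℕ} {S : Set (Fin d → ℝ)}
    {F : MvPolynomial (Fin n) C(S, ℂ)} (hF : IsCondensedElem S F) :
    ∃ (u : C(S, ℂ)) (G : MvPolynomial (Fin n) (MvPolynomial (Fin d) ℂ)),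
      IsUnit u ∧ C u * F = MvPolynomial.map (polyFunHom S) G := by
  classical
  choose p q hq hpq using fun α => (hF α).exists_isUnit_mul_eq
  refine ⟨∏ α ∈ F.support, polyFunHom S (q α),
    ∑ α ∈ F.support, monomial α ((∏ β ∈ F.support.erase α, q β) * p α),
    (IsUnit.prod_iff).2 fun α _ => hq α, ?_⟩
  conv_lhs => rhs; rw [F.as_sum]
  rw [Finset.mul_sum, map_sum]
  refine Finset.sum_congr rfl fun α hα => ?_
  rw [C_mul_monomial, map_monomial, map_mul (polyFunHom S), map_prod, ← hpq α, ← mul_assoc,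
    Finset.prod_erase_mul _ _ hα]

/-- over a condensed space, every condensed ideal of `C[x₁,…,xₙ](S)` is
finitely generated. -/
theorem stmt6 (d n : ℕ) (S : Set (Fin d → ℝ)) (hS : IsCondensed S)
    (I : Ideal (MvPolynomial (Fin n) C(S, ℂ))) (hI : IsCondensedIdeal S I) :
    I.FG := by
  obtain ⟨T, hT, rfl⟩ := hI
  set φ : MvPolynomial (Fin n) (MvPolynomial (Fin d) ℂ) →+* MvPolynomial (Fin n) C(S, ℂ) :=
    MvPolynomial.map (polyFunHom S)
  have h : Ideal.span T = ((Ideal.span T).comap φ).map φ := by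
    refine le_antisymm (Ideal.span_le.2 fun F hFT => ?_) Ideal.map_comap_le
    obtain ⟨u, G, hu, hG⟩ := (hT F hFT).exists_isUnit_mul_eq
    refine (Ideal.unit_mul_mem_iff_mem _ (hu.map C)).1 ?_
    rw [hG]
    refine Ideal.mem_map_of_mem φ (Ideal.mem_comap.2 ?_)
    change MvPolynomial.map (polyFunHom S) G ∈ _
    rw [← hG]
    exact Ideal.mul_mem_left _ _ (Ideal.subset_span hFT)
  rw [h]
  exact Ideal.FG.map (IsNoetherian.noetherian _) φ
end
end

section
/- Let S be a condensed space and J ⊆ C[x₁,…,xₙ](S) a finitely generated almost Groebner ideal. Then √J =_a FRad(J): there is a measure zero set A ⊆ S such that for every f ∈ C[x₁,…,xₙ](S−A), some power of f lies in J(S−A) if and only if f_s ∈ √(J(S−A)|_s) for every s ∈ S−A. -/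
open MvPolynomial

noncomputable section

/-- The quotient of a ring of `k`-valued functions by a maximal ideal is algebraically closed
when `k` is. -/
theorem isAlgClosed_quotient_pi {T k : Type*} [Field k] [IsAlgClosed k] (M : Ideal (T → k))
    [hM : M.IsMaximal] : letI := Ideal.Quotient.field M; IsAlgClosed ((T → k) ⧸ M) := by
  let _ := Ideal.Quotient.field M
  refine IsAlgClosed.of_exists_root _ fun p hp hirr => ?_
  have hlift : p ∈ Polynomial.lifts (Ideal.Quotient.mk M) :=
    Polynomial.mem_lifts_of_surjective Ideal.Quotient.mk_surjective p
  obtain ⟨q, rfl, hdeg, hq⟩ := Polynomial.lifts_and_natDegree_eq_and_monic hlift hp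
  have hroot : ∀ t, ∃ x, (q.map (Pi.evalRingHom (fun _ : T => k) t)).eval x = 0 := fun t =>
    IsAlgClosed.exists_root _ <| by
      rw [Polynomial.degree_eq_natDegree (hq.map _).ne_zero, hq.natDegree_map, hdeg]
      exact_mod_cast hirr.natDegree_pos.ne'
  choose x hx using hroot
  refine ⟨Ideal.Quotient.mk M x, ?_⟩
  have hzero : q.eval x = 0 := by
    funext t
    have h := hx t
    rwa [Polynomial.eval_map, show x t = Pi.evalRingHom (fun _ : T => k) t x from rfl,
      Polynomial.eval₂_hom] at h
  rw [Polynomial.eval_map, Polynomial.eval₂_hom, hzero, map_zero]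

/-- Prime ideals of a ring of functions with values in a field are maximal. -/
theorem isMaximal_of_isPrime_pi {T k : Type*} [Field k] (M : Ideal (T → k))
    [hM : M.IsPrime] : M.IsMaximal := by
  rw [Ideal.isMaximal_iff]
  refine ⟨fun h => hM.ne_top ((Ideal.eq_top_iff_one M).2 h), fun N a hMN haM haN => ?_⟩
  have h0 : a * (1 - a * a⁻¹) = 0 := by
    funext t
    by_cases h : a t = 0 <;> simp [h]
  have h1 : 1 - a * a⁻¹ ∈ M :=
    (hM.mem_or_mem (h0 ▸ M.zero_mem)).resolve_left haM
  simpa using N.add_mem (hMN h1) (N.mul_mem_right a⁻¹ haN)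

/-- If `b` vanishes wherever all elements of a finite subset of a prime ideal `M` vanish, then
`b ∈ M`. -/
theorem mem_of_forall_eq_zero_pi {T k : Type*} [Field k] (M : Ideal (T → k)) [hM : M.IsPrime]
    (s : Finset (T → k)) (hs : ∀ a ∈ s, a ∈ M) (b : T → k)
    (hb : ∀ t, (∀ a ∈ s, a t = 0) → b t = 0) : b ∈ M := by
  have h0 : (∏ a ∈ s, (1 - a * a⁻¹)) * b = 0 := by
    funext t
    by_cases h : ∀ a ∈ s, a t = 0
    · simp [hb t h]
    · push Not at h
      obtain ⟨a, ha, hat⟩ := h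
      rw [Pi.mul_apply, Finset.prod_apply, Finset.prod_eq_zero ha (by simp [hat]), zero_mul,
        Pi.zero_apply]
  refine (hM.mem_or_mem (h0 ▸ M.zero_mem)).resolve_left fun h => ?_
  obtain ⟨a, ha, haM⟩ := hM.prod_mem_iff.1 h
  apply hM.ne_top
  rw [Ideal.eq_top_iff_one]
  simpa using M.add_mem haM (M.mul_mem_right a⁻¹ (hs a ha))

/-- Over a ring of functions with values in an algebraically closed field, membership in the
radical of a finitely generated polynomial ideal can be tested pointwise. -/
theorem mem_radical_of_forall_mem_radical_pi {T k σ : Type*} [Field k] [IsAlgClosed k] [Finite σ]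
    (I : Ideal (MvPolynomial σ (T → k))) (hI : I.FG) (f : MvPolynomial σ (T → k))
    (hf : ∀ t, map (Pi.evalRingHom (fun _ : T => k) t) f ∈
      (I.map (map (Pi.evalRingHom (fun _ : T => k) t))).radical) : f ∈ I.radical := by
  classical
  rw [Ideal.radical_eq_sInf, Submodule.mem_sInf]
  rintro P ⟨hIP, hP⟩
  by_contra hfP
  let M : Ideal (T → k) := Ideal.comap C P
  have hMp : M.IsPrime := Ideal.IsPrime.comap C
  have hMm : M.IsMaximal := isMaximal_of_isPrime_pi M
  let _ := Ideal.Quotient.field M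
  have : IsAlgClosed ((T → k) ⧸ M) := isAlgClosed_quotient_pi M
  let π := Ideal.Quotient.mk M
  have hπ : Function.Surjective (map (σ := σ) π) :=
    map_surjective _ Ideal.Quotient.mk_surjective
  have hker : RingHom.ker (map (σ := σ) π) ≤ P := by
    rw [ker_map, Ideal.mk_ker]
    exact Ideal.map_comap_le
  have hPmap : (Ideal.map (map (σ := σ) π) P).IsPrime := Ideal.map_isPrime_of_surjective hπ hker
  have hf' : map π f ∉ (I.map (map (σ := σ) π)).radical := fun h => by
    have h' := hPmap.radical_le_iff.2 (Ideal.map_mono hIP) h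
    rw [← Ideal.mem_comap, Ideal.comap_map_of_surjective _ hπ] at h'
    exact hfP (sup_le le_rfl hker h')
  rw [← vanishingIdeal_zeroLocus_eq_radical (K := (T → k) ⧸ M), mem_vanishingIdeal_iff] at hf'
  push Not at hf'
  obtain ⟨x, hx, hfx⟩ := hf'
  choose y hy using fun i => Ideal.Quotient.mk_surjective (x i)
  have heval : ∀ g : MvPolynomial σ (T → k), aeval x (map π g) = π (eval y g) := fun g => by
    rw [aeval_eq_eval, eval_map, show x = π ∘ y from (funext hy).symm]
    exact (eval₂_comp _ _ _).symm
  have hevalt : ∀ (t : T) (g : MvPolynomial σ (T → k)),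
      eval (fun i => y i t) (map (Pi.evalRingHom (fun _ : T => k) t) g) = eval y g t :=
    fun t g => by
      rw [eval_map]
      exact (eval₂_comp _ _ _).symm
  rw [heval] at hfx
  obtain ⟨s, rfl⟩ := hI
  refine hfx (Ideal.Quotient.eq_zero_iff_mem.2
    (mem_of_forall_eq_zero_pi M (s.image (eval y)) ?_ _ fun t ht => ?_))
  · intro a ha
    obtain ⟨g, hg, rfl⟩ := Finset.mem_image.1 ha
    rw [← Ideal.Quotient.eq_zero_iff_mem]
    exact (heval g).symm.trans (hx _ (Ideal.mem_map_of_mem _ (Ideal.subset_span hg)))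
  · have hle : (Ideal.span (s : Set (MvPolynomial σ (T → k)))).map
        (map (Pi.evalRingHom (fun _ : T => k) t)) ≤ RingHom.ker (eval fun i => y i t) := by
      rw [Ideal.map_span, Ideal.span_le]
      rintro _ ⟨g, hg, rfl⟩
      rw [SetLike.mem_coe, RingHom.mem_ker, hevalt]
      exact ht _ (Finset.mem_image_of_mem _ hg)
    have h := (RingHom.ker_isPrime _).radical_le_iff.2 hle (hf t)
    rwa [RingHom.mem_ker, hevalt] at h

section Groebner

variable {σ : Type*}

/-- A polynomial in an ideal none of whose monomials is divisible by a leading monomial of a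
generating set of the leading term ideal vanishes. -/
theorem eq_zero_of_mem_of_ltIdeal_le {R : Type*} [CommRing R] (mo : MonomialOrder σ)
    {I : Ideal (MvPolynomial σ R)} {G : Set (MvPolynomial σ R)}
    (hG : ltIdeal mo I ≤ Ideal.span (mLT mo '' G)) {r : MvPolynomial σ R} (hr : r ∈ I)
    (hred : ∀ c ∈ r.support, ∀ b ∈ G, ¬ mo.degree b ≤ c) : r = 0 := by
  classical
  by_contra hne
  have hmem : mLT mo r ∈ Ideal.span ((fun s => monomial s (1 : R)) '' (mo.degree '' G)) := by
    refine (hG.trans (Ideal.span_le.2 ?_)) (Ideal.subset_span ⟨r, hr, hne, rfl⟩)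
    rintro _ ⟨b, hb, rfl⟩
    have : mLT mo b = C (mLC mo b) * monomial (mo.degree b) 1 := by
      rw [C_mul_monomial, mul_one]; rfl
    rw [this]
    exact Ideal.mul_mem_left _ _ (Ideal.subset_span ⟨_, ⟨b, hb, rfl⟩, rfl⟩)
  have hdeg : mo.degree r ∈ r.support := mo.degree_mem_support hne
  have hdeg' : mo.degree r ∈ (mLT mo r).support := by
    rw [mem_support_iff] at hdeg ⊢
    rw [show mLT mo r = monomial (mo.degree r) (r.coeff (mo.degree r)) from rfl, coeff_monomial,
      if_pos rfl]
    exact hdeg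
  obtain ⟨_, ⟨b, hb, rfl⟩, hle⟩ := mem_ideal_span_monomial_image.1 hmem _ hdeg'
  exact hred _ hdeg b hb hle

/-- Division by a subset of `I` with unit leading coefficients, as a decomposition modulo `I`. -/
theorem exists_eq_add_reduced {R : Type*} [CommRing R] (mo : MonomialOrder σ)
    {I : Ideal (MvPolynomial σ R)} {G : Set (MvPolynomial σ R)} (hGI : G ⊆ I)
    (hunit : ∀ b ∈ G, IsUnit (mo.leadingCoeff b)) (f : MvPolynomial σ R) :
    ∃ p, ∃ i ∈ I, f = i + p ∧ ∀ c ∈ p.support, ∀ b ∈ G, ¬ mo.degree b ≤ c := by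
  obtain ⟨g, p, hf, -, hp⟩ := mo.div_set hunit f
  refine ⟨p, _, ?_, hf, hp⟩
  rw [Finsupp.linearCombination_apply]
  exact I.sum_mem fun b _ => I.mul_mem_left _ (hGI b.2)

/-- Let `G ⊆ I` have unit leading coefficients, with leading terms generating the leading term
ideal of `I`. A polynomial reduced with respect to `G` whose image under a surjective coefficient
change lies in the image of `I` has zero image. -/
theorem map_eq_zero_of_map_mem {R k : Type*} [CommRing R] [CommRing k]
    (mo : MonomialOrder σ) {I : Ideal (MvPolynomial σ R)} {G : Set (MvPolynomial σ R)}
    (hGI : G ⊆ I) (hunit : ∀ b ∈ G, IsUnit (mo.leadingCoeff b))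
    (hG : ltIdeal mo I ≤ Ideal.span (mLT mo '' G)) (φ : R →+* k) (hφ : Function.Surjective φ)
    {r : MvPolynomial σ R} (hred : ∀ c ∈ r.support, ∀ b ∈ G, ¬ mo.degree b ≤ c)
    (hr : map φ r ∈ I.map (map φ)) : map φ r = 0 := by
  have hdiv : ∀ f : MvPolynomial σ R, ∃ p, f - p ∈ I ∧
      ∀ c ∈ p.support, ∀ b ∈ G, ¬ mo.degree b ≤ c := fun f => by
    obtain ⟨p, i, hi, rfl, hp⟩ := exists_eq_add_reduced mo hGI hunit f
    exact ⟨p, by rwa [add_sub_cancel_right], hp⟩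
  choose p hpI hp using hdiv
  obtain ⟨F, hF, hFr⟩ := (Ideal.mem_map_iff_of_surjective _ (map_surjective _ hφ)).1 hr
  let e := r - F
  have he : ∀ α, φ (e.coeff α) = 0 := fun α => by
    rw [← coeff_map, map_sub, hFr, sub_self, coeff_zero]
  let q := e.support.sum fun α => C (e.coeff α) * p (monomial α 1)
  have hq : map φ q = 0 := by
    rw [map_sum]
    refine Finset.sum_eq_zero fun α _ => ?_
    rw [map_mul, map_C, he, C_0, zero_mul]
  have heq : e - q ∈ I := by
    have : e = e.support.sum fun α => C (e.coeff α) * monomial α 1 := by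
      conv_lhs => rw [e.as_sum]
      simp only [C_mul_monomial, mul_one]
    rw [show e - q = e.support.sum fun α => C (e.coeff α) * (monomial α 1 - p (monomial α 1)) by
      simp only [mul_sub, Finset.sum_sub_distrib, ← this, q]]
    exact I.sum_mem fun α _ => I.mul_mem_left _ (hpI _)
  have hrq : r - q = 0 := by
    refine eq_zero_of_mem_of_ltIdeal_le mo hG ?_ fun c hc b hb hle => ?_
    · rw [show r - q = F + (e - q) by simp only [e]; ring]
      exact I.add_mem hF heq
    · rw [mem_support_iff] at hc
      apply hc
      rw [coeff_sub, coeff_sum]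
      have h0 : ∀ u : MvPolynomial σ R, (∀ c ∈ u.support, ∀ b ∈ G, ¬ mo.degree b ≤ c) →
          u.coeff c = 0 := fun u hu => by
        by_contra h
        exact hu c (mem_support_iff.2 h) b hb hle
      rw [h0 r hred, zero_sub, neg_eq_zero]
      exact Finset.sum_eq_zero fun α _ => by rw [coeff_C_mul, h0 _ (hp _), mul_zero]
  rw [sub_eq_zero.1 hrq, hq]

end Groebner

/-- For a Groebner ideal, membership can be tested on fibres. -/
theorem IsGroebnerIdeal.mem_of_forall_fiberMap_mem {T : Type} [TopologicalSpace T] {n : ℕ}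
    {mo : MonomialOrder (Fin n)} {I : Ideal (MvPolynomial (Fin n) C(T, ℂ))}
    (hI : IsGroebnerIdeal T mo I) {f : MvPolynomial (Fin n) C(T, ℂ)}
    (hf : ∀ t : T, fiberMap n t f ∈ I.map (fiberMap n t)) : f ∈ I := by
  obtain ⟨G, hspan, hLC, hLT⟩ := hI
  have hGI : (G : Set (MvPolynomial (Fin n) C(T, ℂ))) ⊆ I := hspan ▸ Ideal.subset_span
  have hunit : ∀ b ∈ (G : Set (MvPolynomial (Fin n) C(T, ℂ))), IsUnit (mo.leadingCoeff b) :=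
    fun b hb => ContinuousMap.isUnit_iff_forall_ne_zero _ |>.2 (hLC b hb)
  obtain ⟨r, i, hi, rfl, hr⟩ := exists_eq_add_reduced mo hGI hunit f
  have hr0 : ∀ t : T, fiberMap n t r = 0 := fun t => by
    refine map_eq_zero_of_map_mem mo hGI hunit hLT.ge (evalAt t)
      (fun z => ⟨ContinuousMap.const T z, rfl⟩) hr ?_
    have h := hf t
    rw [map_add] at h
    exact (Ideal.add_mem_iff_right _ (Ideal.mem_map_of_mem (fiberMap n t) hi)).1 h
  have : r = 0 := by
    ext α t
    have h := congrArg (coeff α) (hr0 t)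
    rwa [fiberMap, coeff_map] at h
  rwa [this, add_zero]

/-- For a Groebner ideal, membership in the radical can be tested on fibres. -/
theorem IsGroebnerIdeal.mem_radical_of_forall_fiberMap_mem_radical {T : Type} [TopologicalSpace T]
    {n : ℕ} {mo : MonomialOrder (Fin n)} {I : Ideal (MvPolynomial (Fin n) C(T, ℂ))}
    (hI : IsGroebnerIdeal T mo I) {f : MvPolynomial (Fin n) C(T, ℂ)}
    (hf : ∀ t : T, fiberMap n t f ∈ (I.map (fiberMap n t)).radical) : f ∈ I.radical := by
  let ι : C(T, ℂ) →+* (T → ℂ) := ContinuousMap.coeFnRingHom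
  have hcomp : ∀ t : T, (map (σ := Fin n) (Pi.evalRingHom (fun _ : T => ℂ) t)).comp (map ι) =
      fiberMap n t := fun t => by
    refine RingHom.ext fun x => ?_
    exact map_map _ _ _
  have hFG : I.FG := by
    obtain ⟨G, hspan, -⟩ := hI
    exact ⟨G, hspan⟩
  have hrad : map ι f ∈ (I.map (map ι)).radical := by
    refine mem_radical_of_forall_mem_radical_pi _ (hFG.map _) _ fun t => ?_
    rw [Ideal.map_map, hcomp, ← RingHom.comp_apply, hcomp]
    exact hf t
  obtain ⟨m, hm⟩ := hrad
  refine ⟨m, hI.mem_of_forall_fiberMap_mem fun t => ?_⟩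
  have h := Ideal.mem_map_of_mem (map (Pi.evalRingHom (fun _ : T => ℂ) t)) hm
  rwa [Ideal.map_map, hcomp, ← map_pow, ← RingHom.comp_apply, hcomp] at h

/-- for a finitely generated almost Groebner ideal `J` over a condensed
space, `√J =_a FRad(J)`: off a measure zero set, some power of `f` lies in `J(S−A)` iff
every fibre `f_s` lies in the radical of the fibre ideal `J(S−A)|_s`. -/
theorem stmt9 (d n : ℕ) (S : Set (Fin d → ℝ)) (hS : IsCondensed S)
    (mo : MonomialOrder (Fin n)) (J : Ideal (MvPolynomial (Fin n) C(S, ℂ)))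
    (hfg : J.FG) (hAG : IsAlmostGroebner mo J) :
    ∃ A : Set (Fin d → ℝ), MeasureZero S A ∧
      ∀ f : MvPolynomial (Fin n) C((S \ A : Set (Fin d → ℝ)), ℂ),
        (∃ m : ℕ, f ^ m ∈ idealRes J (Set.diff_subset : S \ A ⊆ S)) ↔
          ∀ s : ↥(S \ A), fiberMap n s f ∈
            ((idealRes J (Set.diff_subset : S \ A ⊆ S)).map (fiberMap n s)).radical := by
  obtain ⟨A, hA, hG⟩ := hAG
  refine ⟨A, hA, fun f => ⟨?_, hG.mem_radical_of_forall_fiberMap_mem_radical⟩⟩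
  rintro ⟨m, hm⟩ s
  exact ⟨m, map_pow (fiberMap n s) f m ▸ Ideal.mem_map_of_mem _ hm⟩
end
end

section
/- Let S be a condensed space and J ⊆ C[x₁,…,xₙ](S) a finitely generated almost Groebner ideal. Then √J =_a IV(J): there is a measure zero set A ⊆ S such that for every f ∈ C[x₁,…,xₙ](S−A), some power of f lies in J(S−A) if and only if f_s(x) = 0 for every point (s,x) ∈ (S−A) × ℂⁿ with g_s(x) = 0 for all g ∈ J(S−A). -/
open MvPolynomial

noncomputable section

theorem germ_isAlgClosed {α k : Type*} [Field k] [IsAlgClosed k] (φ : Ultrafilter α) :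
    IsAlgClosed (Filter.Germ (φ : Filter α) k) := by
  refine IsAlgClosed.of_exists_root _ fun p hp hirr => ?_
  have hsurj : Function.Surjective (Filter.Germ.coeRingHom (R := k) (φ : Filter α)) :=
    fun x => Filter.Germ.inductionOn x fun g => ⟨g, rfl⟩
  have hlift : p ∈ Polynomial.lifts (Filter.Germ.coeRingHom (R := k) (φ : Filter α)) :=
    (Polynomial.mem_lifts p).2 (Polynomial.map_surjective _ hsurj p)
  obtain ⟨q, hqp, hqd, hqm⟩ := Polynomial.lifts_and_natDegree_eq_and_monic hlift hp
  have hroot : ∀ a, ∃ z, (q.map (Pi.evalRingHom (fun _ : α => k) a)).eval z = 0 := fun a => by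
    refine IsAlgClosed.exists_root _ fun h => hirr.natDegree_pos.ne' ?_
    rw [← hqd, ← hqm.natDegree_map (Pi.evalRingHom (fun _ : α => k) a)]
    exact Polynomial.natDegree_eq_of_degree_eq_some h
  choose z hz using hroot
  refine ⟨Filter.Germ.coeRingHom (φ : Filter α) z, ?_⟩
  have hqz : q.eval z = 0 := funext fun a => by
    have h := hz a
    rwa [Polynomial.eval_map, show z a = Pi.evalRingHom (fun _ : α => k) a z from rfl,
      Polynomial.eval₂_at_apply] at h
  rw [← hqp, Polynomial.eval_map_apply, hqz, map_zero]

theorem eventually_map_eval_eq_zero {α k σ : Type*} [CommRing k] {l : Filter α}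
    {p : MvPolynomial σ (α → k)}
    (hp : MvPolynomial.map (Filter.Germ.coeRingHom (R := k) l) p = 0) :
    ∀ᶠ a in l, MvPolynomial.map (Pi.evalRingHom (fun _ : α => k) a) p = 0 := by
  have hcoeff : ∀ c ∈ p.support, ∀ᶠ a in l, p.coeff c a = 0 := fun c _ => by
    have h := congrArg (MvPolynomial.coeff c) hp
    rw [MvPolynomial.coeff_map, MvPolynomial.coeff_zero] at h
    exact Filter.Germ.coe_eq.1 h
  filter_upwards [(Finset.eventually_all p.support).2 hcoeff] with a ha
  ext c
  rw [MvPolynomial.coeff_map, MvPolynomial.coeff_zero]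
  by_cases hc : c ∈ p.support
  · exact ha c hc
  · rw [MvPolynomial.notMem_support_iff.1 hc, map_zero]

theorem eval_map_evalRingHom {α k σ : Type*} [CommRing k] (p : MvPolynomial σ (α → k))
    (ξ : σ → α → k) (a : α) :
    MvPolynomial.eval (fun i => ξ i a) (MvPolynomial.map (Pi.evalRingHom (fun _ : α => k) a) p) =
      MvPolynomial.eval ξ p a := by
  rw [MvPolynomial.eval_map]
  exact (MvPolynomial.eval₂_comp_left (Pi.evalRingHom (fun _ : α => k) a) (RingHom.id _) ξ p).symm

/-- A Nullstellensatz with an exponent uniform in a family of specializations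
`ev a : R → k` of a finitely generated ideal. -/
theorem exists_uniform_pow_mem {R T k σ : Type*} [CommRing R] [Field k] [IsAlgClosed k] [Finite σ]
    (ev : T → R →+* k) {I : Ideal (MvPolynomial σ R)} (hI : I.FG) (f : MvPolynomial σ R)
    (hf : ∀ (t : T) (x : σ → k),
      (∀ g ∈ I, MvPolynomial.eval x (MvPolynomial.map (ev t) g) = 0) →
        MvPolynomial.eval x (MvPolynomial.map (ev t) f) = 0) :
    ∃ m : ℕ, ∀ t, MvPolynomial.map (ev t) f ^ m ∈ I.map (MvPolynomial.map (ev t)) := by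
  by_contra! hcon
  choose s hs using hcon
  let φ : Ultrafilter ℕ := Filter.hyperfilter ℕ
  let K := Filter.Germ (φ : Filter ℕ) k
  have : IsAlgClosed K := germ_isAlgClosed φ
  let γ : (ℕ → k) →+* K := Filter.Germ.coeRingHom (φ : Filter ℕ)
  let e : R →+* (ℕ → k) := RingHom.pi fun j => ev (s j)
  have hγ : Function.Surjective γ := fun x => Filter.Germ.inductionOn x fun g => ⟨g, rfl⟩
  have hspec : ∀ (j : ℕ) (p : MvPolynomial σ R),
      MvPolynomial.map (Pi.evalRingHom (fun _ : ℕ => k) j) (MvPolynomial.map e p) =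
        MvPolynomial.map (ev (s j)) p := fun j p => MvPolynomial.map_map _ _ p
  have hrad : MvPolynomial.map γ (MvPolynomial.map e f) ∈
      ((I.map (MvPolynomial.map e)).map (MvPolynomial.map γ)).radical := by
    rw [← MvPolynomial.vanishingIdeal_zeroLocus_eq_radical (K := K)]
    intro x hx
    choose ξ hξ using fun i => hγ (x i)
    have hx' : x = γ ∘ ξ := (funext hξ).symm
    have heval : ∀ p : MvPolynomial σ R,
        MvPolynomial.aeval x (MvPolynomial.map γ (MvPolynomial.map e p)) =
          γ (MvPolynomial.eval ξ (MvPolynomial.map e p)) := fun p => by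
      rw [hx', MvPolynomial.map_eval, MvPolynomial.aeval_eq_eval]
    have hgerm : ∀ p : MvPolynomial σ R,
        MvPolynomial.aeval x (MvPolynomial.map γ (MvPolynomial.map e p)) = 0 ↔
          ∀ᶠ j in (φ : Filter ℕ), MvPolynomial.eval (fun i => ξ i j)
            (MvPolynomial.map (ev (s j)) p) = 0 := fun p => by
      rw [heval]
      simp only [← hspec, eval_map_evalRingHom]
      exact Filter.Germ.coe_eq
    obtain ⟨G, rfl⟩ := hI
    rw [hgerm]
    have hG : ∀ g ∈ G, ∀ᶠ j in (φ : Filter ℕ), MvPolynomial.eval (fun i => ξ i j)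
        (MvPolynomial.map (ev (s j)) g) = 0 := fun g hg =>
      (hgerm g).1 (hx _ (Ideal.mem_map_of_mem _ (Ideal.mem_map_of_mem _ (Ideal.subset_span hg))))
    filter_upwards [(Finset.eventually_all G).2 hG] with j hj
    refine hf _ _ fun g hg => ?_
    have hle : Ideal.span (G : Set (MvPolynomial σ R)) ≤ RingHom.ker
        ((MvPolynomial.eval fun i => ξ i j).comp (MvPolynomial.map (ev (s j)))) :=
      Ideal.span_le.2 fun g hg => hj g hg
    exact hle hg
  obtain ⟨m, hm⟩ := hrad
  obtain ⟨q, hq, hqm⟩ :=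
    (Ideal.mem_map_iff_of_surjective _ (MvPolynomial.map_surjective γ hγ)).1 hm
  have hzero : MvPolynomial.map γ (q - MvPolynomial.map e f ^ m) = 0 := by
    rw [map_sub, map_pow, hqm, sub_self]
  have hlarge : ∀ᶠ j in (φ : Filter ℕ), m ≤ j :=
    (Nat.hyperfilter_le_atTop) (Filter.eventually_ge_atTop m)
  obtain ⟨j, hj, hmj⟩ := ((eventually_map_eval_eq_zero hzero).and hlarge).exists
  refine hs j (Ideal.pow_mem_of_pow_mem _ ?_ hmj)
  rw [map_sub, map_pow, hspec, sub_eq_zero] at hj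
  rw [← hj, show (MvPolynomial.map (ev (s j)) : MvPolynomial σ R →+* _) =
    (MvPolynomial.map (Pi.evalRingHom (fun _ : ℕ => k) j)).comp (MvPolynomial.map e) from
      RingHom.ext fun p => (hspec j p).symm, ← Ideal.map_map]
  exact Ideal.mem_map_of_mem _ hq

/-- Membership in an ideal complemented by the span of a set of monomials can be tested
on specializations which jointly detect zero. -/
theorem mem_of_forall_map_mem {R T k σ : Type*} [CommRing R] [CommRing k]
    (ev : T → R →+* k) (hsurj : ∀ t, Function.Surjective (ev t))
    (hinj : ∀ r : R, (∀ t, ev t r = 0) → r = 0)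
    {I : Ideal (MvPolynomial σ R)} {B : Set (σ →₀ ℕ)}
    (hdisj : ∀ p ∈ I, p ∈ MvPolynomial.restrictSupport R B → p = 0)
    (hcod : ∀ p, ∃ r ∈ MvPolynomial.restrictSupport R B, p - r ∈ I)
    {f : MvPolynomial σ R}
    (hf : ∀ t, MvPolynomial.map (ev t) f ∈ I.map (MvPolynomial.map (ev t))) : f ∈ I := by
  obtain ⟨r, hrB, hrI⟩ := hcod f
  suffices hr : r = 0 by rwa [hr, sub_zero] at hrI
  have hfib : ∀ t, MvPolynomial.map (ev t) r = 0 := fun t => by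
    have hmem : MvPolynomial.map (ev t) r ∈ I.map (MvPolynomial.map (ev t)) := by
      have h := sub_mem (hf t) (Ideal.mem_map_of_mem (MvPolynomial.map (ev t)) hrI)
      rwa [← map_sub, sub_sub_cancel] at h
    obtain ⟨p, hp, hpr⟩ :=
      (Ideal.mem_map_iff_of_surjective _ (MvPolynomial.map_surjective _ (hsurj t))).1 hmem
    choose ν hνB hνI using fun α : σ →₀ ℕ => hcod (MvPolynomial.monomial α 1)
    let w : MvPolynomial σ R := ∑ α ∈ (r - p).support, (r - p).coeff α • ν α
    have hwB : w ∈ MvPolynomial.restrictSupport R B :=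
      Submodule.sum_mem _ fun α _ => Submodule.smul_mem _ _ (hνB α)
    have hwI : r - p - w ∈ I := by
      have hsum : r - p - w = ∑ α ∈ (r - p).support,
          MvPolynomial.C ((r - p).coeff α) * (MvPolynomial.monomial α 1 - ν α) := by
        simp only [mul_sub, MvPolynomial.C_mul_monomial, mul_one, Finset.sum_sub_distrib,
          MvPolynomial.support_sum_monomial_coeff, w, MvPolynomial.smul_eq_C_mul]
      rw [hsum]
      exact Submodule.sum_mem _ fun α _ => I.mul_mem_left _ (hνI α)
    have hrw : r = w := sub_eq_zero.1 <| hdisj _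
      (by simpa only [sub_right_comm r p w, sub_add_cancel] using add_mem hwI hp) (sub_mem hrB hwB)
    have hcoeff : ∀ α, ev t ((r - p).coeff α) = 0 := fun α => by
      rw [← MvPolynomial.coeff_map, map_sub, hpr, sub_self, MvPolynomial.coeff_zero]
    rw [hrw, map_sum]
    refine Finset.sum_eq_zero fun α _ => ?_
    rw [MvPolynomial.smul_eq_C_mul, map_mul, MvPolynomial.map_C, hcoeff, map_zero, zero_mul]
  ext α : 1
  refine hinj _ fun t => ?_
  rw [← MvPolynomial.coeff_map, hfib, MvPolynomial.coeff_zero]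

theorem IsGroebnerBasis.mem_of_forall_fiber_mem {n : ℕ} {T : Type} [TopologicalSpace T]
    {mo : MonomialOrder (Fin n)} {I : Ideal (MvPolynomial (Fin n) C(T, ℂ))}
    {G : Finset (MvPolynomial (Fin n) C(T, ℂ))} (hG : IsGroebnerBasis T mo I G)
    {f : MvPolynomial (Fin n) C(T, ℂ)}
    (hf : ∀ t, fiberMap n t f ∈ I.map (fiberMap n t)) : f ∈ I := by
  obtain ⟨hspan, hlc, hlt⟩ := hG
  refine mem_of_forall_map_mem evalAt (fun t z => ⟨ContinuousMap.const T z, rfl⟩)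
    (fun r hr => ContinuousMap.ext hr) (B := {c | ∀ g ∈ G, ¬ mo.degree g ≤ c}) ?_ ?_ hf
  · intro p hpI hpB
    by_contra hp
    have hle : ltIdeal mo I ≤
        Ideal.span ((fun c => MvPolynomial.monomial c 1) '' (mo.degree '' (G : Set (MvPolynomial (Fin n) C(T, ℂ))))) := by
      rw [← hlt, Ideal.span_le]
      rintro _ ⟨g, hg, rfl⟩
      rw [mLT, ← mul_one (mLC mo g), ← MvPolynomial.C_mul_monomial]
      exact Ideal.mul_mem_left _ _ (Ideal.subset_span ⟨_, ⟨g, hg, rfl⟩, rfl⟩)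
    have hmem := MvPolynomial.mem_ideal_span_monomial_image.1
      (hle (Ideal.subset_span ⟨p, hpI, hp, rfl⟩ : mLT mo p ∈ ltIdeal mo I))
    have hdeg : mo.degree p ∈ (mLT mo p).support := by
      rw [MvPolynomial.mem_support_iff, mLT]
      change MvPolynomial.coeff (mDegree mo p) _ ≠ 0
      rw [MvPolynomial.coeff_monomial, if_pos rfl]
      exact mo.coeff_degree_ne_zero_iff.2 hp
    obtain ⟨_, ⟨g, hg, rfl⟩, hgp⟩ := hmem _ hdeg
    exact hpB ((mo.degree_mem_support_iff p).2 hp) g hg hgp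
  · intro p
    obtain ⟨c, r, hpr, -, hr⟩ := mo.div_set (B := (G : Set (MvPolynomial (Fin n) C(T, ℂ))))
      (fun g hg => ContinuousMap.isUnit_iff_forall_ne_zero _ |>.2 (hlc g hg)) p
    refine ⟨r, fun α hα => hr α hα, ?_⟩
    rw [hpr, add_sub_cancel_right, ← hspan, Finsupp.linearCombination_apply]
    exact Submodule.sum_mem _ fun g _ => Ideal.mul_mem_left _ _ (Ideal.subset_span g.2)

/-- for a finitely generated almost Groebner ideal `J` over a condensed
space, `√J =_a IV(J)`: off a measure zero set, some power of `f` lies in `J(S−A)` iff `f`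
vanishes at every common zero of `J(S−A)` in `(S−A) × ℂⁿ`. -/
theorem stmt10 (d n : ℕ) (S : Set (Fin d → ℝ)) (hS : IsCondensed S)
    (mo : MonomialOrder (Fin n)) (J : Ideal (MvPolynomial (Fin n) C(S, ℂ)))
    (hfg : J.FG) (hAG : IsAlmostGroebner mo J) :
    ∃ A : Set (Fin d → ℝ), MeasureZero S A ∧
      ∀ f : MvPolynomial (Fin n) C((S \ A : Set (Fin d → ℝ)), ℂ),
        (∃ m : ℕ, f ^ m ∈ idealRes J (Set.diff_subset : S \ A ⊆ S)) ↔
          ∀ p : ↥(S \ A) × (Fin n → ℂ),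
            (∀ g ∈ idealRes J (Set.diff_subset : S \ A ⊆ S),
                MvPolynomial.eval p.2 (fiberMap n p.1 g) = 0) →
              MvPolynomial.eval p.2 (fiberMap n p.1 f) = 0 := by
  obtain ⟨A, hA, G, hG⟩ := hAG
  refine ⟨A, hA, fun f => ⟨?_, fun hf => ?_⟩⟩
  · rintro ⟨m, hm⟩ p hp
    have h := hp _ hm
    rw [map_pow, map_pow] at h
    exact eq_zero_of_pow_eq_zero h
  · obtain ⟨m, hm⟩ := exists_uniform_pow_mem evalAt ⟨G, hG.1⟩ f fun t x hx => hf (t, x) hx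
    refine ⟨m, hG.mem_of_forall_fiber_mem fun t => ?_⟩
    rw [map_pow]
    exact hm t
end
end

section
/- Elimination theorem: let S be a topological space and J ⊆ C[x₁,…,xₙ](S) a Groebner ideal with Groebner basis G with respect to the lexicographic monomial order with x₁ > x₂ > ⋯ > xₙ. Then for every ℓ with 0 ≤ ℓ ≤ n, the set G_ℓ := G ∩ C[x_{ℓ+1},…,xₙ](S) is a Groebner basis of the ℓ-th elimination ideal J_ℓ := J ∩ C[x_{ℓ+1},…,xₙ](S), regarded as an ideal of C[x_{ℓ+1},…,xₙ](S). -/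
open MvPolynomial

noncomputable section

open scoped MonomialOrder in
theorem toSyn_lex_mapDomain_strictMono {σ τ : Type*} [LinearOrder σ] [WellFoundedGT σ]
    [LinearOrder τ] [WellFoundedGT τ] {f : σ → τ} (hf : StrictMono f) {a b : σ →₀ ℕ}
    (h : a ≺[MonomialOrder.lex] b) :
    a.mapDomain f ≺[MonomialOrder.lex] b.mapDomain f := by
  rw [MonomialOrder.lex_lt_iff, Finsupp.Lex.lt_iff] at h ⊢
  obtain ⟨i, hlt, hi⟩ := h
  refine ⟨f i, fun j hj => ?_, ?_⟩
  · by_cases hr : j ∈ Set.range f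
    · obtain ⟨k, rfl⟩ := hr
      simpa [Finsupp.mapDomain_apply hf.injective] using hlt k (hf.lt_iff_lt.1 hj)
    · simp [Finsupp.mapDomain_of_notMem_range _ _ hr]
  · simpa [Finsupp.mapDomain_apply hf.injective] using hi

theorem degree_lex_rename {σ τ R : Type*} [CommSemiring R] [LinearOrder σ] [WellFoundedGT σ]
    [LinearOrder τ] [WellFoundedGT τ] {f : σ → τ} (hf : StrictMono f) (p : MvPolynomial σ R) :
    MonomialOrder.lex.degree (rename f p) = (MonomialOrder.lex.degree p).mapDomain f := by
  classical
  by_cases hp : p = 0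
  · simp [hp]
  apply MonomialOrder.lex.toSyn.injective
  apply le_antisymm
  · rw [MonomialOrder.degree_le_iff]
    intro c hc
    rw [support_rename_of_injective hf.injective, Finset.mem_image] at hc
    obtain ⟨d, hd, rfl⟩ := hc
    rcases (MonomialOrder.lex.le_degree hd).lt_or_eq with h | h
    · exact (toSyn_lex_mapDomain_strictMono hf h).le
    · rw [MonomialOrder.lex.toSyn.injective h]
  · apply MonomialOrder.le_degree
    rw [support_rename_of_injective hf.injective]
    exact Finset.mem_image_of_mem _ (MonomialOrder.lex.degree_mem_support hp)

theorem leadingCoeff_lex_rename {σ τ R : Type*} [CommSemiring R] [LinearOrder σ]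
    [WellFoundedGT σ] [LinearOrder τ] [WellFoundedGT τ] {f : σ → τ} (hf : StrictMono f)
    (p : MvPolynomial σ R) :
    MonomialOrder.lex.leadingCoeff (rename f p) = MonomialOrder.lex.leadingCoeff p := by
  rw [MonomialOrder.leadingCoeff, degree_lex_rename hf, coeff_rename_mapDomain f hf.injective,
    MonomialOrder.leadingCoeff]

/-- Under the lexicographic order, the leading monomial of a polynomial involves its largest
variable. -/
theorem vars_subset_of_degree_lex_eq_zero {σ R : Type*} [CommSemiring R] [LinearOrder σ]
    [WellFoundedGT σ] {s : Set σ} (hs : IsUpperSet s) {p : MvPolynomial σ R}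
    (hp : ∀ i ∉ s, MonomialOrder.lex.degree p i = 0) : (p.vars : Set σ) ⊆ s := by
  intro i hi
  by_contra his
  obtain ⟨d, hd, hid⟩ := (mem_vars_iff_mem_support i).1 hi
  rw [Finsupp.mem_support_iff] at hid
  rcases (MonomialOrder.lex.le_degree hd).lt_or_eq with h | h
  · rw [MonomialOrder.lex_lt_iff, Finsupp.Lex.lt_iff] at h
    obtain ⟨j, hlt, hj⟩ := h
    have hjs : j ∈ s := by
      by_contra hjs
      exact absurd hj (by simp [hp j hjs])
    have hij : i < j := lt_of_not_ge fun hji => his (hs hji hjs)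
    exact hid ((hlt i hij).trans (hp i his))
  · rw [MonomialOrder.lex.toSyn.injective h] at hid
    exact hid (hp i his)

theorem exists_degree_le_of_span_leadingTerm_eq {σ R : Type*} [CommRing R]
    {m : MonomialOrder σ} {I : Ideal (MvPolynomial σ R)} {G : Set (MvPolynomial σ R)}
    (h : Ideal.span (m.leadingTerm '' G) = ltIdeal m I) {f : MvPolynomial σ R} (hf : f ∈ I)
    (hf0 : f ≠ 0) : ∃ g ∈ G, m.degree g ≤ m.degree f := by
  classical
  have hmem : m.leadingTerm f ∈ Ideal.span (m.leadingTerm '' G) :=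
    h ▸ Ideal.subset_span ⟨f, hf, hf0, rfl⟩
  have hle : Ideal.span (m.leadingTerm '' G) ≤
      Ideal.span ((fun s => monomial s (1 : R)) '' (m.degree '' G)) := by
    rw [Ideal.span_le]
    rintro _ ⟨g, hg, rfl⟩
    rw [SetLike.mem_coe, ← MonomialOrder.C_mul_leadingCoeff_monomial_degree]
    exact Ideal.mul_mem_left _ _ (Ideal.subset_span ⟨_, ⟨g, hg, rfl⟩, rfl⟩)
  obtain ⟨_, ⟨g, hg, rfl⟩, hgf⟩ := mem_ideal_span_monomial_image.1 (hle hmem) (m.degree f) (by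
    rwa [mem_support_iff, MonomialOrder.leadingTerm, coeff_monomial, if_pos rfl,
      MonomialOrder.leadingCoeff_ne_zero_iff])
  exact ⟨g, hg, hgf⟩

theorem span_eq_of_forall_exists_degree_le {σ R : Type*} [CommRing R] {m : MonomialOrder σ}
    {I : Ideal (MvPolynomial σ R)} {G : Set (MvPolynomial σ R)} (hGI : G ⊆ I)
    (hu : ∀ g ∈ G, IsUnit (m.leadingCoeff g))
    (h : ∀ f ∈ I, f ≠ 0 → ∃ g ∈ G, m.degree g ≤ m.degree f) : Ideal.span G = I := by
  refine le_antisymm (Ideal.span_le.2 hGI) fun f hf => ?_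
  obtain ⟨c, r, hfr, -, hr⟩ := m.div_set hu f
  have hlin : Finsupp.linearCombination _ (fun b : G => (b : MvPolynomial σ R)) c ∈
      Ideal.span G :=
    Submodule.sum_mem _ fun b _ => Ideal.mul_mem_left _ _ (Ideal.subset_span b.2)
  have hrI : r ∈ I := by
    rw [← I.add_mem_iff_right (Ideal.span_le.2 hGI hlin), ← hfr]
    exact hf
  have hr0 : r = 0 := by
    by_contra hr0
    obtain ⟨g, hg, hgr⟩ := h r hrI hr0
    exact hr _ (m.degree_mem_support hr0) g hg hgr
  rwa [hfr, hr0, add_zero]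

theorem span_leadingTerm_eq_of_forall_exists_degree_le {σ R : Type*} [CommRing R]
    {m : MonomialOrder σ} {I : Ideal (MvPolynomial σ R)} {G : Set (MvPolynomial σ R)}
    (hGI : G ⊆ I) (hu : ∀ g ∈ G, IsUnit (m.leadingCoeff g))
    (h : ∀ f ∈ I, f ≠ 0 → ∃ g ∈ G, m.degree g ≤ m.degree f) :
    Ideal.span (m.leadingTerm '' G) = ltIdeal m I := by
  apply le_antisymm
  · rw [Ideal.span_le]
    rintro _ ⟨g, hg, rfl⟩
    by_cases hg0 : g = 0
    · simp [hg0]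
    · exact Ideal.subset_span ⟨g, hGI hg, hg0, rfl⟩
  · rw [ltIdeal, Ideal.span_le]
    rintro _ ⟨f, hf, hf0, rfl⟩
    obtain ⟨g, hg, hgf⟩ := h f hf hf0
    have hdvd : m.leadingTerm g ∣ m.leadingTerm f :=
      monomial_dvd_monomial.2 ⟨Or.inr hgf, (hu g hg).dvd⟩
    exact Ideal.mem_of_dvd _ hdvd (Ideal.subset_span ⟨g, hg, rfl⟩)

/-- Elimination theorem: if `G` is a Groebner basis of
`J ⊆ C[x₁,…,xₙ](S)` for the lexicographic order with `x₁ > x₂ > ⋯ > xₙ`, then for every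
`0 ≤ ℓ ≤ n` the set `G_ℓ = G ∩ C[x_{ℓ+1},…,xₙ](S)` is a Groebner basis of the `ℓ`-th
elimination ideal `J_ℓ = J ∩ C[x_{ℓ+1},…,xₙ](S)`.  The subring `C[x_{ℓ+1},…,xₙ](S)` is
realized as `MvPolynomial {i : Fin n // ℓ ≤ i} C(S,ℂ)` embedded by `rename Subtype.val`,
so that `J_ℓ` is the `comap` of `J` and `G_ℓ` the preimage of `G`. -/
theorem stmt12 (S : Type) [TopologicalSpace S] (n : ℕ)
    (J : Ideal (MvPolynomial (Fin n) C(S, ℂ))) (G : Finset (MvPolynomial (Fin n) C(S, ℂ)))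
    (hG : IsGroebnerBasis S MonomialOrder.lex J G) (ℓ : ℕ) (hℓ : ℓ ≤ n)
    (Gl : Finset (MvPolynomial {i : Fin n // ℓ ≤ (i : ℕ)} C(S, ℂ)))
    (hGl : (Gl : Set (MvPolynomial {i : Fin n // ℓ ≤ (i : ℕ)} C(S, ℂ)))
      = (MvPolynomial.rename (Subtype.val : {i : Fin n // ℓ ≤ (i : ℕ)} → Fin n))
          ⁻¹' (G : Set (MvPolynomial (Fin n) C(S, ℂ)))) :
    IsGroebnerBasis S MonomialOrder.lex
      (Ideal.comap
        (MvPolynomial.rename (Subtype.val : {i : Fin n // ℓ ≤ (i : ℕ)} → Fin n) :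
          MvPolynomial {i : Fin n // ℓ ≤ (i : ℕ)} C(S, ℂ) →ₐ[C(S, ℂ)]
            MvPolynomial (Fin n) C(S, ℂ)) J)
      Gl := by
  obtain ⟨hspan, hne, hlt⟩ := hG
  have hval : StrictMono (Subtype.val : {i : Fin n // ℓ ≤ (i : ℕ)} → Fin n) :=
    Subtype.strictMono_coe _
  have hmem : ∀ g, g ∈ Gl ↔ rename Subtype.val g ∈ G := fun g => Set.ext_iff.1 hGl g
  have hGI : (Gl : Set _) ⊆ (Ideal.comap (rename Subtype.val :
      MvPolynomial {i : Fin n // ℓ ≤ (i : ℕ)} C(S, ℂ) →ₐ[C(S, ℂ)] _) J : Set _) :=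
    fun g hg => hspan ▸ Ideal.subset_span ((hmem g).1 hg)
  have hneGl : ∀ g ∈ Gl, ∀ t : S, mLC MonomialOrder.lex g t ≠ 0 := by
    intro g hg t
    have h := hne _ ((hmem g).1 hg) t
    have hlc := leadingCoeff_lex_rename hval g
    change mLC MonomialOrder.lex _ = mLC MonomialOrder.lex _ at hlc
    rwa [hlc] at h
  have hu : ∀ g ∈ (Gl : Set _), IsUnit (MonomialOrder.lex.leadingCoeff g) := fun g hg =>
    (ContinuousMap.isUnit_iff_forall_ne_zero _).2 (hneGl g hg)
  have hdeg : ∀ f ∈ Ideal.comap (rename Subtype.val :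
      MvPolynomial {i : Fin n // ℓ ≤ (i : ℕ)} C(S, ℂ) →ₐ[C(S, ℂ)] _) J, f ≠ 0 →
      ∃ g ∈ (Gl : Set (MvPolynomial _ C(S, ℂ))),
        MonomialOrder.lex.degree g ≤ MonomialOrder.lex.degree f := by
    intro f hf hf0
    obtain ⟨g, hg, hgf⟩ := exists_degree_le_of_span_leadingTerm_eq hlt hf
      ((map_ne_zero_iff _ (rename_injective _ hval.injective)).2 hf0)
    rw [degree_lex_rename hval] at hgf
    have hvars : (g.vars : Set (Fin n)) ⊆ {i | ℓ ≤ (i : ℕ)} := by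
      refine vars_subset_of_degree_lex_eq_zero (s := {i : Fin n | ℓ ≤ (i : ℕ)})
        (fun i j hij (hi : ℓ ≤ (i : ℕ)) => hi.trans hij) fun i hi => ?_
      refine Nat.le_zero.1 ((hgf i).trans_eq (Finsupp.mapDomain_of_notMem_range _ _ ?_))
      simpa using hi
    obtain ⟨g, rfl⟩ := exists_rename_eq_of_vars_subset_range g Subtype.val hval.injective
      (hvars.trans_eq Subtype.range_coe.symm)
    rw [degree_lex_rename hval, Finsupp.mapDomain_le_mapDomain_iff_le hval.injective] at hgf
    exact ⟨g, (hmem g).2 hg, hgf⟩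
  exact ⟨span_eq_of_forall_exists_degree_le hGI hu hdeg, hneGl,
    span_leadingTerm_eq_of_forall_exists_degree_le hGI hu hdeg⟩
end
end
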